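/- There is a constant K > 0 such that for all integers T ≥ 1, |C(T) − (1/24)·F(T)²| ≤ K·T³. -/

import Mathlib

/-- The set of Farey fractions of order `T`: rationals `a/b` with
`0 ≤ a < b ≤ T` and `gcd(a,b) = 1`, viewed as a finite set of rationals in `[0,1)`. -/
def farey (T : ℕ) : Finset ℚ :=
  (((Finset.range (T + 1)) ×ˢ (Finset.range (T + 1))).filter
    (fun p => p.1 < p.2 ∧ Nat.gcd p.1 p.2 = 1)).image (fun p => (p.1 : ℚ) / (p.2 : ℚ))

/-- `F(T)` is the number of Farey fractions of order `T`. -/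
def F (T : ℕ) : ℕ := (farey T).card

/-- The Farey fractions of order `T` lying in `[0, 1/2]`. -/
def fareyHalf (T : ℕ) : Finset ℚ := (farey T).filter (fun q => q ≤ 1 / 2)

/-- `C(T) = ∑_{a/b ∈ 𝓕(T) ∩ [0,1/2]} #(𝓕(T) ∩ [1 - a²/b², 1])`, where a Farey fraction
`q = a/b` in lowest terms satisfies `a²/b² = q²`. -/
def C (T : ℕ) : ℕ :=
  ∑ q ∈ fareyHalf T, ((farey T).filter (fun ξ => 1 - q ^ 2 ≤ ξ ∧ ξ ≤ 1)).card

/-- `G(T) = ∑_{ξ ∈ 𝓕(T), ξ ≤ 1/2} ξ²`. -/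
noncomputable def G (T : ℕ) : ℝ := ∑ q ∈ fareyHalf T, (q : ℝ) ^ 2

/-- The Mertens function `M(n) = ∑_{1 ≤ k ≤ n} μ(k)`. -/
def mertens (n : ℕ) : ℤ := ∑ k ∈ Finset.Icc 1 n, ArithmeticFunction.moebius k

lemma aux_M1 (N : ℕ) (hN : 1 ≤ N) : ∑ k ∈ Finset.Ioc 0 N, mertens (N / k) = 1 := by
  have h := ArithmeticFunction.sum_Ioc_mul_eq_sum_sum (ArithmeticFunction.zeta : ArithmeticFunction ℤ) ArithmeticFunction.moebius N
  rw [ArithmeticFunction.coe_zeta_mul_moebius] at h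
  have h1 : ∑ n ∈ Finset.Ioc 0 N, (1 : ArithmeticFunction ℤ) n = 1 := by
    rw [Finset.sum_eq_single 1]
    · simp
    · intro b _ hb
      exact ArithmeticFunction.one_apply_ne hb
    · intro h; simp at h; omega
  rw [h1] at h
  rw [h]
  apply Finset.sum_congr rfl
  intro k hk
  have : k ≠ 0 := by simp at hk; omega
  simp [ArithmeticFunction.natCoe_apply, ArithmeticFunction.zeta_apply, this, mertens]
  rfl

lemma aux_Md (T d : ℕ) (hd : 1 ≤ d) (hT : d ≤ T) :
    ∑ n ∈ (Finset.Ioc 0 T).filter (fun n => d ∣ n), mertens (T / n) = 1 := by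
  rw [← aux_M1 (T / d) (by rw [Nat.le_div_iff_mul_le hd]; omega)]
  symm
  apply Finset.sum_bij (fun e _ => d * e)
  · intro e he
    simp only [Finset.mem_Ioc, Finset.mem_filter] at he ⊢
    refine ⟨⟨by nlinarith, ?_⟩, dvd_mul_right _ _⟩
    have := (Nat.le_div_iff_mul_le hd).1 he.2
    linarith
  · intro a _ b _ h
    exact Nat.eq_of_mul_eq_mul_left hd h
  · intro n hn
    simp only [Finset.mem_Ioc, Finset.mem_filter] at hn
    obtain ⟨⟨h1, h2⟩, e, rfl⟩ := hn
    refine ⟨e, ?_, rfl⟩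
    simp only [Finset.mem_Ioc]
    refine ⟨Nat.pos_of_mul_pos_left h1, ?_⟩
    rw [Nat.le_div_iff_mul_le hd]; linarith
  · intro e _
    rw [Nat.div_div_eq_div_mul]

lemma aux_mem (T : ℕ) (q : ℚ) : q ∈ farey T ↔ 0 ≤ q ∧ q < 1 ∧ q.den ≤ T := by
  unfold farey
  simp only [Finset.mem_image, Finset.mem_filter, Finset.mem_product, Finset.mem_range]
  constructor
  · rintro ⟨⟨a, b⟩, ⟨⟨h1, h2⟩, h3, h4⟩, rfl⟩
    simp only at *
    have hb : (0:ℚ) < b := by exact_mod_cast (by omega : 0 < b)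
    refine ⟨by positivity, ?_, ?_⟩
    · rw [div_lt_one hb]; exact_mod_cast h3
    · have := Rat.den_div_eq_of_coprime (a := (a:ℤ)) (b := (b:ℤ)) (by exact_mod_cast hb) (by simpa using h4)
      push_cast at this
      have h5 : ((a:ℚ) / b).den = b := by exact_mod_cast this
      omega
  · rintro ⟨h0, h1, h2⟩
    have hn : (q.num.toNat : ℤ) = q.num := Int.toNat_of_nonneg (Rat.num_nonneg.2 h0)
    have hlt : q.num.toNat < q.den := by
      have := Rat.num_lt_denom_iff.2 h1 
      omega
    refine ⟨(q.num.toNat, q.den), ⟨⟨by simp; omega, by simp; omega⟩, hlt, ?_⟩, ?_⟩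
    · have := q.reduced
      have h : q.num.natAbs = q.num.toNat := by omega
      rw [h] at this
      exact this
    · simp only
      have : ((q.num.toNat : ℕ) : ℚ) = (q.num : ℚ) := by exact_mod_cast hn
      rw [this]; exact Rat.num_div_den q

lemma aux_fib (T n : ℕ) (hn : 0 < n) (hT : n ≤ T) (f : ℚ → ℝ) :
    ∑ a ∈ Finset.range n, f ((a : ℚ) / n) = ∑ q ∈ (farey T).filter (fun q => q.den ∣ n), f q := by
  have hn' : (0:ℚ) < n := by exact_mod_cast hn
  apply Finset.sum_bij (fun (a : ℕ) _ => (a : ℚ) / n)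
  · intro a ha
    simp only [Finset.mem_range] at ha
    have hd : ((a:ℚ) / n).den ∣ n := by
      have := Rat.den_dvd (a : ℤ) (n : ℤ)
      rw [Rat.divInt_eq_div, Int.cast_natCast, Int.cast_natCast] at this
      exact Int.natCast_dvd_natCast.1 this
    rw [Finset.mem_filter, aux_mem]
    refine ⟨⟨by positivity, ?_, (Nat.le_of_dvd hn hd).trans hT⟩, hd⟩
    rw [div_lt_one hn']; exact_mod_cast ha
  · intro a _ b _ h
    field_simp at h
    exact_mod_cast h
  · intro q hq
    rw [Finset.mem_filter, aux_mem] at hq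
    obtain ⟨⟨h0, h1, h2⟩, e, he⟩ := hq
    have hnn : (q.num.toNat : ℤ) = q.num := Int.toNat_of_nonneg (Rat.num_nonneg.2 h0)
    have h3 : ((q.num.toNat : ℕ) : ℚ) = (q.num : ℚ) := by exact_mod_cast hnn
    have hqq : ((q.num.toNat * e : ℕ) : ℚ) / n = q := by
      have hd : (q.den : ℚ) ≠ 0 := by exact_mod_cast q.den_nz
      have he' : (n : ℚ) = q.den * e := by exact_mod_cast he
      have he0 : (e : ℚ) ≠ 0 := by
        rintro h; rw [h] at he'; simp at he'; omega
      push_cast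
      rw [h3, he', mul_div_mul_right _ _ he0]
      exact Rat.num_div_den q
    refine ⟨q.num.toNat * e, ?_, hqq⟩
    rw [Finset.mem_range]
    rw [← hqq, div_lt_one hn'] at h1
    exact_mod_cast h1
  · intro a _; rfl

lemma aux_L1 (T : ℕ) (f : ℚ → ℝ) :
    ∑ q ∈ farey T, f q =
      ∑ n ∈ Finset.Ioc 0 T, (mertens (T / n) : ℝ) * ∑ a ∈ Finset.range n, f ((a : ℚ) / n) := by
  have h : ∀ n ∈ Finset.Ioc 0 T, (mertens (T / n) : ℝ) * ∑ a ∈ Finset.range n, f ((a : ℚ) / n)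
      = ∑ q ∈ farey T, if q.den ∣ n then (mertens (T / n) : ℝ) * f q else 0 := by
    intro n hn
    simp only [Finset.mem_Ioc] at hn
    rw [aux_fib T n hn.1 hn.2, Finset.mul_sum, Finset.sum_filter]
  rw [Finset.sum_congr rfl h, Finset.sum_comm]
  apply Finset.sum_congr rfl
  intro q hq
  rw [aux_mem] at hq
  rw [← Finset.sum_filter, ← Finset.sum_mul]
  have := aux_Md T q.den q.den_pos hq.2.2
  rw [← Int.cast_sum, this]
  simp

lemma aux_Mbound (T n : ℕ) : |(mertens (T / n) : ℝ)| ≤ (T : ℝ) / n := by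
  have h : |mertens (T / n)| ≤ ((T / n : ℕ) : ℤ) := by
    unfold mertens
    refine (Finset.abs_sum_le_sum_abs _ _).trans ?_
    refine (Finset.sum_le_card_nsmul _ _ 1 (fun k _ => ArithmeticFunction.abs_moebius_le_one)).trans ?_
    simp
  have h2 : |(mertens (T / n) : ℝ)| ≤ ((T / n : ℕ) : ℝ) := by
    have h' : ((|mertens (T / n)| : ℤ) : ℝ) ≤ (((T / n : ℕ) : ℤ) : ℝ) := Int.cast_le.2 h
    rwa [Int.cast_abs, Int.cast_natCast] at h'
  exact h2.trans Nat.cast_div_le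

lemma aux_sqrt (J : ℕ) : |∑ j ∈ Finset.Ioc 0 J, √(j:ℝ) - (2/3 * √(J:ℝ)^3 + 1/2 * √(J:ℝ))| ≤ 1/3 := by
  have key : ∀ J : ℕ, ∑ j ∈ Finset.Ioc 0 (J+1), √(j:ℝ) - (2/3 * √((J+1:ℕ):ℝ)^3 + 1/2 * √((J+1:ℕ):ℝ)) ≤ 0
     ∧ -1/3 + 1/(6 * √((J+1:ℕ):ℝ)) ≤ ∑ j ∈ Finset.Ioc 0 (J+1), √(j:ℝ) - (2/3 * √((J+1:ℕ):ℝ)^3 + 1/2 * √((J+1:ℕ):ℝ)) := by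
    intro J
    induction J with
    | zero => norm_num
    | succ J ih =>
      rw [Finset.sum_Ioc_succ_top (by omega)]
      set r := √((J+1:ℕ):ℝ) with hr
      set t := √((J+1+1:ℕ):ℝ) with ht
      set S := ∑ j ∈ Finset.Ioc 0 (J+1), √(j:ℝ)
      have hr2 : r^2 = J+1 := by rw [hr, Real.sq_sqrt (by positivity)]; push_cast; ring
      have ht2 : t^2 = J+1+1 := by rw [ht, Real.sq_sqrt (by positivity)]; push_cast; ring
      have hr0 : 0 < r := by rw [hr]; positivity
      have ht0 : 0 < t := by rw [ht]; positivity
      have h1 : t^2 - r^2 = 1 := by rw [hr2, ht2]; ring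
      have hrt : r < t := by nlinarith
      have e : t - (2/3 * t^3 + 1/2 * t) + (2/3 * r^3 + 1/2 * r) = -(t-r)^3/6 := by
        linear_combination (1/2 * (r+t)) * (-h1)
      have hp : 0 < (t-r)^3 := by apply pow_pos; linarith
      refine ⟨by linarith [ih.1], ?_⟩
      have hq : (t-r)^3 ≤ 1/r - 1/t := by
        have : 1/r - 1/t = (t-r)/(r*t) := by field_simp
        rw [this, le_div_iff₀ (by positivity)]
        have hh : (t-r)^2*(r*t) ≤ 1 := by
          have : (t-r)^2*(t+r)^2 = 1 := by
            have : (t-r)^2*(t+r)^2 = (t^2-r^2)^2 := by ring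
            rw [this, h1]; norm_num
          nlinarith [sq_nonneg (t-r), mul_nonneg (sq_nonneg (t-r)) (by positivity : 0 ≤ t^2+r*t+r^2)]
        nlinarith
      have e1 : 1/(6*r) = (1/r)/6 := by field_simp
      have e2 : 1/(6*t) = (1/t)/6 := by field_simp
      rw [e2]; rw [e1] at ih
      linarith [ih.2]
  cases J with
  | zero => simp
  | succ J =>
    obtain ⟨h1, h2⟩ := key J
    have : 0 ≤ 1/(6 * √((J+1:ℕ):ℝ)) := by positivity
    rw [abs_le]
    constructor <;> linarith

/-- counting of a ≤ k above a threshold -/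
lemma aux_count (k : ℕ) (z : ℝ) (h0 : 0 < z) (hk : z ≤ k) :
    |(((Finset.range (k+1)).filter (fun a : ℕ => z ≤ a)).card : ℝ) - (k - z)| ≤ 1 := by
  have : (Finset.range (k+1)).filter (fun a : ℕ => z ≤ a) = Finset.Ico ⌈z⌉₊ (k+1) := by
    ext a
    simp only [Finset.mem_filter, Finset.mem_range, Finset.mem_Ico, Nat.ceil_le]
    tauto
  rw [this, Nat.card_Ico]
  have h1 : ⌈z⌉₊ ≤ k := Nat.ceil_le.2 hk
  rw [Nat.cast_sub (by omega)]
  have h2 := Nat.le_ceil z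
  have h3 := Nat.ceil_lt_add_one h0.le
  push_cast
  rw [abs_le]; constructor <;> linarith

lemma aux_sumsq (k : ℕ) : ∑ a ∈ Finset.range (k+1), (a:ℝ)^2 = k*(k+1)*(2*k+1)/6 := by
  induction k with
  | zero => simp
  | succ k ih => rw [Finset.sum_range_succ, ih]; push_cast; ring

lemma aux_floor (m n k : ℕ) (hm : 0 < m) (hn : 0 < n) :
    |∑ a ∈ Finset.range (k+1), (⌊(m:ℝ) * ((a:ℝ)/n)^2⌋₊ : ℝ) -
      ((⌊(m:ℝ) * ((k:ℝ)/n)^2⌋₊ : ℝ) * k - (n / √(m:ℝ)) * ∑ j ∈ Finset.Ioc 0 ⌊(m:ℝ) * ((k:ℝ)/n)^2⌋₊, √(j:ℝ))|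
      ≤ ⌊(m:ℝ) * ((k:ℝ)/n)^2⌋₊ := by
  set J := ⌊(m:ℝ) * ((k:ℝ)/n)^2⌋₊ with hJ
  set x := (n / √(m:ℝ)) with hx
  have hm' : (0:ℝ) < m := by exact_mod_cast hm
  have hn' : (0:ℝ) < n := by exact_mod_cast hn
  have hsm : 0 < √(m:ℝ) := by positivity
  have hx0 : 0 < x := by positivity
  have hiff : ∀ a j : ℕ, (j:ℝ) ≤ (m:ℝ) * ((a:ℝ)/n)^2 ↔ x * √(j:ℝ) ≤ a := by
    intro a j
    have e : (m:ℝ) * ((a:ℝ)/n)^2 = (a/x)^2 := by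
      rw [hx]; field_simp; rw [Real.sq_sqrt hm'.le]; ring
    rw [e, ← Real.sqrt_le_left (by positivity), le_div_iff₀ hx0, mul_comm]
  have h1 : ∀ a ∈ Finset.range (k+1), (⌊(m:ℝ) * ((a:ℝ)/n)^2⌋₊ : ℝ) =
      ∑ j ∈ Finset.Ioc 0 J, if x * √(j:ℝ) ≤ a then (1:ℝ) else 0 := by
    intro a ha
    rw [← Finset.sum_filter, Finset.sum_const, nsmul_eq_mul, mul_one]
    have : (Finset.Ioc 0 J).filter (fun j : ℕ => x * √(j:ℝ) ≤ a) = Finset.Ioc 0 ⌊(m:ℝ) * ((a:ℝ)/n)^2⌋₊ := by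
      ext j
      simp only [Finset.mem_filter, Finset.mem_Ioc]
      rw [← hiff, Nat.le_floor_iff (a := (m:ℝ) * ((a:ℝ)/n)^2) (by positivity)]
      constructor
      · tauto
      · rintro ⟨h, h'⟩
        refine ⟨⟨h, ?_⟩, h'⟩
        rw [hJ, Nat.le_floor_iff (by positivity)]
        refine h'.trans ?_
        have : (a:ℝ) ≤ k := by
          simp only [Finset.mem_range] at ha
          exact_mod_cast (by omega : a ≤ k)
        gcongr
    rw [this]; simp
  rw [Finset.sum_congr rfl h1, Finset.sum_comm]
  have h2 : (J:ℝ) * k - x * ∑ j ∈ Finset.Ioc 0 J, √(j:ℝ) = ∑ j ∈ Finset.Ioc 0 J, ((k:ℝ) - x * √(j:ℝ)) := by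
    rw [Finset.sum_sub_distrib, Finset.mul_sum]; simp
  rw [h2, ← Finset.sum_sub_distrib]
  refine (Finset.abs_sum_le_sum_abs _ _).trans ?_
  refine (Finset.sum_le_card_nsmul _ _ 1 ?_).trans (by simp)
  intro j hj
  simp only [Finset.mem_Ioc] at hj
  rw [← Finset.sum_filter, Finset.sum_const, nsmul_eq_mul, mul_one]
  apply aux_count
  · have : (0:ℝ) < j := by exact_mod_cast hj.1
    positivity
  · rw [← hiff]
    exact (Nat.le_floor_iff (by positivity)).1 hj.2

lemma aux_Q (R S : ℝ) (hR0 : 0 ≤ R) (hle : R ≤ S) (hSR : S^2 < R^2 + 1) :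
    -1/2 ≤ S^3/3 - S/2 - R^2*S + 2/3*R^3 + R/2 ∧ S^3/3 - S/2 - R^2*S + 2/3*R^3 + R/2 ≤ 2/3 := by
  have hQe : S^3/3 - S/2 - R^2*S + 2/3*R^3 + R/2 = (S-R)*((S-R)*(S+2*R))/3 - (S-R)/2 := by ring
  have hd1 : S - R ≤ 1 := by nlinarith
  have hd0 : 0 ≤ S - R := by linarith
  have hd2 : (S-R)*(S+2*R) ≤ 2 := by nlinarith
  have hd3 : 0 ≤ (S-R)*(S+2*R) := mul_nonneg hd0 (by linarith)
  have hd4 := mul_nonneg hd0 hd3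
  have hd5 : (S-R)*((S-R)*(S+2*R)) ≤ 1 * 2 := mul_le_mul hd1 hd2 hd3 (by norm_num)
  rw [hQe]
  constructor <;> linarith

lemma aux_B (m n k : ℕ) (hm : 0 < m) (hn : 0 < n) (hk : 2 * k ≤ n) :
    |∑ a ∈ Finset.range (k+1), ((m:ℝ) * ((a:ℝ)/n)^2 - 1/2 - (⌊(m:ℝ) * ((a:ℝ)/n)^2⌋₊ : ℝ))|
      ≤ n / √(m:ℝ) + 3 * m := by
  have hf := aux_floor m n k hm hn
  have hs := aux_sqrt ⌊(m:ℝ) * ((k:ℝ)/n)^2⌋₊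
  set J := ⌊(m:ℝ) * ((k:ℝ)/n)^2⌋₊ with hJ
  set x := (n / √(m:ℝ)) with hx
  set FL := ∑ a ∈ Finset.range (k+1), (⌊(m:ℝ) * ((a:ℝ)/n)^2⌋₊ : ℝ) with hFL
  set SQ := ∑ j ∈ Finset.Ioc 0 J, √(j:ℝ) with hSQ
  have hm' : (1:ℝ) ≤ m := by exact_mod_cast hm
  have hn' : (0:ℝ) < n := by exact_mod_cast hn
  have hk' : 2 * (k:ℝ) ≤ n := by exact_mod_cast hk
  have hsm : 0 < √(m:ℝ) := by positivity
  have hx0 : 0 < x := by positivity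
  set S := (k:ℝ)/x with hS
  have hkS : (k:ℝ) = x * S := by rw [hS]; field_simp
  have hS0 : 0 ≤ S := by positivity
  set R := √(J:ℝ) with hR
  have hR0 : 0 ≤ R := Real.sqrt_nonneg _
  have hR2 : R^2 = J := Real.sq_sqrt (by positivity)
  have hSe : (m:ℝ) * ((k:ℝ)/n)^2 = S^2 := by
    rw [hS, hx]; field_simp; rw [Real.sq_sqrt (by linarith)]; ring
  have hRS : R^2 ≤ S^2 := by
    rw [hR2, ← hSe]; exact Nat.floor_le (by positivity)
  have hSR : S^2 < R^2 + 1 := by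
    rw [hR2, ← hSe]; exact Nat.lt_floor_add_one _
  have hle : R ≤ S := by nlinarith
  have hS4 : 4 * S^2 ≤ m := by
    rw [← hSe]
    have : (k:ℝ)/n ≤ 1/2 := by rw [div_le_iff₀ hn']; linarith
    have h0 : 0 ≤ (k:ℝ)/n := by positivity
    have : ((k:ℝ)/n)^2 ≤ 1/4 := by nlinarith
    nlinarith
  have hsum : ∑ a ∈ Finset.range (k+1), ((m:ℝ) * ((a:ℝ)/n)^2 - 1/2 - (⌊(m:ℝ) * ((a:ℝ)/n)^2⌋₊ : ℝ))
      = (k*(k+1)*(2*k+1)/6) / x^2 - (k+1)/2 - FL := by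
    rw [Finset.sum_sub_distrib, Finset.sum_sub_distrib, ← aux_sumsq, ← hFL, Finset.sum_div]
    congr 2
    · apply Finset.sum_congr rfl
      intro a _
      rw [hx]; field_simp; rw [Real.sq_sqrt (by linarith)]; ring
    · simp; ring
  rw [hsum]
  have hee : (k*(k+1)*(2*k+1)/6) / x^2 = x * S^3/3 + (3*k^2+k)/(6*x^2) := by
    rw [hkS]; field_simp; ring
  have he0 : 0 ≤ (3*(k:ℝ)^2+k)/(6*x^2) := by positivity
  have he1 : (3*(k:ℝ)^2+k)/(6*x^2) ≤ m := by
    have : (k:ℝ) ≤ k^2 := by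
      have : k ≤ k^2 := Nat.le_self_pow (by norm_num) k
      exact_mod_cast this
    have : (3*(k:ℝ)^2+k)/(6*x^2) ≤ (4*k^2)/(6*x^2) := by gcongr; linarith
    have h2 : (4*(k:ℝ)^2)/(6*x^2) = 2/3*S^2 := by rw [hkS]; field_simp; ring
    linarith
  set e := (3*(k:ℝ)^2+k)/(6*x^2)
  rw [hee]
  have hJm : (J:ℝ) ≤ m := by rw [← hR2]; linarith [sq_nonneg S]
  rw [abs_le] at hf hs
  set Q := S^3/3 - S/2 - R^2*S + 2/3*R^3 + R/2 with hQ
  obtain ⟨hQ0, hQ1⟩ : -1/2 ≤ Q ∧ Q ≤ 2/3 := aux_Q R S hR0 hle hSR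
  have hxs1 : x * (SQ - (2/3*R^3+1/2*R)) ≤ x * (1/3) := by gcongr; exact hs.2
  have hxs0 : x * (-(1/3)) ≤ x * (SQ - (2/3*R^3+1/2*R)) := by gcongr; exact hs.1
  have hxQ1 : x * Q ≤ x * (2/3) := by gcongr
  have hxQ0 : x * (-1/2) ≤ x * Q := by gcongr
  have hJk : (J:ℝ) * k = x * (R^2 * S) := by rw [← hR2, hkS]; ring
  have hxQe : x * Q = x * S^3/3 - k/2 - J*k + x * (2/3*R^3+1/2*R) := by
    rw [hJk, hkS, hQ]; ring
  rw [mul_sub] at hxs1 hxs0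
  rw [abs_le]
  constructor <;> linarith [hf.1, hf.2]

lemma aux_Btriv (m n k : ℕ) (hn : 0 < n) (hk : 2 * k ≤ n) :
    |∑ a ∈ Finset.range (k+1), ((m:ℝ) * ((a:ℝ)/n)^2 - 1/2 - (⌊(m:ℝ) * ((a:ℝ)/n)^2⌋₊ : ℝ))|
      ≤ (n:ℝ) := by
  refine (Finset.abs_sum_le_sum_abs _ _).trans ?_
  refine (Finset.sum_le_card_nsmul _ _ 1 ?_).trans ?_
  · intro a _
    have h1 := Nat.floor_le (show 0 ≤ (m:ℝ) * ((a:ℝ)/n)^2 by positivity)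
    have h2 := Nat.lt_floor_add_one ((m:ℝ) * ((a:ℝ)/n)^2)
    rw [abs_le]; constructor <;> linarith
  · simp
    exact_mod_cast (by omega : k + 1 ≤ n)

lemma aux_32 (T : ℕ) : ∑ m ∈ Finset.Ioc 0 T, 1 / ((m:ℝ) * √(m:ℝ)) ≤ 3 := by
  have key : ∀ J : ℕ, ∑ m ∈ Finset.Ioc 0 (J+1), 1 / ((m:ℝ) * √(m:ℝ)) ≤ 3 - 2 / √((J+1:ℕ):ℝ) := by
    intro J
    induction J with
    | zero => norm_num
    | succ J ih =>
      rw [Finset.sum_Ioc_succ_top (by omega)]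
      set r := √((J+1:ℕ):ℝ) with hr
      set t := √((J+1+1:ℕ):ℝ) with ht
      have hr2 : r^2 = J+1 := by rw [hr, Real.sq_sqrt (by positivity)]; push_cast; ring
      have ht2 : t^2 = ((J+1+1:ℕ):ℝ) := by rw [ht, Real.sq_sqrt (by positivity)]
      have hr0 : 0 < r := by rw [hr]; positivity
      have ht0 : 0 < t := by rw [ht]; positivity
      have h1 : t^2 - r^2 = 1 := by rw [hr2, ht2]; push_cast; ring
      have hrt : r < t := by nlinarith
      rw [← ht2]
      have : 1/(t^2*t) ≤ 2/r - 2/t := by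
        have e : 2/r - 2/t = 2*(t-r)/(r*t) := by field_simp
        rw [e, div_le_div_iff₀ (by positivity) (by positivity)]
        have : 1 ≤ 2 * (t-r) * t := by nlinarith
        have h5 : r * t ≤ t^2 := by nlinarith
        have h6 : t^2 * 1 ≤ t^2 * (2 * (t-r) * t) := by gcongr
        nlinarith
      linarith
  cases T with
  | zero => simp
  | succ J =>
    have h := key J
    have : 0 ≤ 2 / √((J+1:ℕ):ℝ) := by positivity
    linarith

lemma aux_sq (T : ℕ) : ∑ m ∈ Finset.Ioc 0 T, 1 / ((m:ℝ)^2) ≤ 3 := by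
  refine le_trans (Finset.sum_le_sum ?_) (aux_32 T)
  intro m hm
  simp only [Finset.mem_Ioc] at hm
  have h1 : (1:ℝ) ≤ m := by exact_mod_cast hm.1
  have h2 : √(m:ℝ) ≤ m := by rw [Real.sqrt_le_left (by linarith)]; nlinarith
  rw [pow_two]
  gcongr

lemma aux_minsum (T : ℕ) :
    ∑ m ∈ Finset.Ioc 0 T, ∑ n ∈ Finset.Ioc 0 T, (min (m:ℝ) n) / (m * n) ≤ 2 * T := by
  have h1 : ∑ m ∈ Finset.Ioc 0 T, ∑ n ∈ Finset.Ioc 0 T, (if n ≤ m then 1/(m:ℝ) else 0) = T := by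
    have : ∀ m ∈ Finset.Ioc 0 T, ∑ n ∈ Finset.Ioc 0 T, (if n ≤ m then 1/(m:ℝ) else 0) = 1 := by
      intro m hm
      simp only [Finset.mem_Ioc] at hm
      rw [← Finset.sum_filter]
      have : (Finset.Ioc 0 T).filter (fun n => n ≤ m) = Finset.Ioc 0 m := by
        ext n; simp; omega
      rw [this]
      have : (m:ℝ) ≠ 0 := by exact_mod_cast (by omega : m ≠ 0)
      simp [this]
    rw [Finset.sum_congr rfl this]; simp
  have h2 : ∑ m ∈ Finset.Ioc 0 T, ∑ n ∈ Finset.Ioc 0 T, (if m ≤ n then 1/(n:ℝ) else 0) = T := by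
    rw [Finset.sum_comm]; exact h1
  have : (2:ℝ) * T = T + T := by ring
  rw [this]
  nth_rw 2 [← h1]
  rw [← h2, ← Finset.sum_add_distrib]
  apply Finset.sum_le_sum
  intro m hm
  rw [← Finset.sum_add_distrib]
  apply Finset.sum_le_sum
  intro n hn
  simp only [Finset.mem_Ioc] at hm hn
  have hm' : (0:ℝ) < m := by exact_mod_cast hm.1
  have hn' : (0:ℝ) < n := by exact_mod_cast hn.1
  rcases le_total m n with h | h
  · have h' : (m:ℝ) ≤ n := by exact_mod_cast h
    rw [if_pos h, min_eq_left h']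
    have : (m:ℝ) / (m * n) = 1 / n := by field_simp
    rw [this]
    split_ifs
    · have : 0 < 1/(m:ℝ) := by positivity
      linarith
    · linarith
  · have h' : (n:ℝ) ≤ m := by exact_mod_cast h
    rw [if_pos h, min_eq_right h']
    have : (n:ℝ) / (m * n) = 1 / m := by field_simp
    rw [this]
    split_ifs
    · have : 0 < 1/(n:ℝ) := by positivity
      linarith
    · linarith

lemma aux_L2 (T : ℕ) (g : ℚ → ℝ) :
    ∑ q ∈ fareyHalf T, g q =
      ∑ n ∈ Finset.Ioc 0 T, (mertens (T / n) : ℝ) * ∑ a ∈ Finset.range (n / 2 + 1), g ((a : ℚ) / n) := by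
  unfold fareyHalf
  rw [Finset.sum_filter, aux_L1]
  apply Finset.sum_congr rfl
  intro n hn
  simp only [Finset.mem_Ioc] at hn
  have hn' : (0:ℚ) < n := by exact_mod_cast hn.1
  rw [← Finset.sum_filter]
  congr 2
  ext a
  simp only [Finset.mem_filter, Finset.mem_range]
  rw [div_le_div_iff₀ hn' (by norm_num)]
  have : ((a:ℚ) * 2 ≤ 1 * n) ↔ a * 2 ≤ 1 * n := by exact_mod_cast Iff.rfl
  rw [this]
  omega

lemma aux_F (T : ℕ) : (F T : ℝ) = ∑ n ∈ Finset.Ioc 0 T, (mertens (T / n) : ℝ) * n := by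
  have := aux_L1 T (fun _ => 1)
  simpa [F] using this

lemma aux_F_le (T : ℕ) : (F T : ℝ) ≤ (T : ℝ)^2 := by
  rw [aux_F]
  have : ∑ n ∈ Finset.Ioc 0 T, (mertens (T / n) : ℝ) * n ≤ ∑ n ∈ Finset.Ioc 0 T, (T : ℝ) := by
    apply Finset.sum_le_sum
    intro n hn
    simp only [Finset.mem_Ioc] at hn
    have hn' : (0:ℝ) < n := by exact_mod_cast hn.1
    have := (le_abs_self _).trans (aux_Mbound T n)
    rwa [le_div_iff₀ hn'] at this
  refine this.trans ?_
  simp [pow_two]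

lemma aux_N (T : ℕ) (q : ℚ) (h0 : 0 ≤ q) (h1 : q ≤ 1 / 2) :
    (((farey T).filter (fun ξ => 1 - q ^ 2 ≤ ξ ∧ ξ ≤ 1)).card : ℝ) =
      ∑ n ∈ Finset.Ioc 0 T, (mertens (T / n) : ℝ) * (⌊(n:ℝ) * (q:ℝ)^2⌋₊ : ℝ) := by
  have h := aux_L1 T (fun ξ => if 1 - q ^ 2 ≤ ξ ∧ ξ ≤ 1 then 1 else 0)
  rw [← Finset.sum_filter, Finset.sum_const, nsmul_eq_mul, mul_one] at h
  rw [h]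
  apply Finset.sum_congr rfl
  intro n hn
  simp only [Finset.mem_Ioc] at hn
  have hn' : (0:ℚ) < n := by exact_mod_cast hn.1
  rw [← Finset.sum_filter, Finset.sum_const, nsmul_eq_mul, mul_one]
  congr 2
  set J := ⌊(n:ℝ) * (q:ℝ)^2⌋₊ with hJ
  have hJn : J ≤ n := by
    apply Nat.floor_le_of_le
    have : (q:ℝ) ≤ 1/2 := by
      have h' : (q:ℝ) ≤ ((1/2 : ℚ) : ℝ) := Rat.cast_le.2 h1
      push_cast at h'
      exact h'
    have h00 : (0:ℝ) ≤ q := by exact_mod_cast h0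
    have hn'' : (0:ℝ) < n := by exact_mod_cast hn.1
    have : (q:ℝ)^2 ≤ 1 := by nlinarith
    nlinarith
  have : (Finset.range n).filter (fun a : ℕ => 1 - q ^ 2 ≤ (a:ℚ) / n ∧ (a:ℚ) / n ≤ 1) = Finset.Ico (n - J) n := by
    ext a
    simp only [Finset.mem_filter, Finset.mem_range, Finset.mem_Ico]
    rw [le_div_iff₀ hn', div_le_one hn']
    have key : a < n → ((1 - q^2) * n ≤ a ↔ n - J ≤ a) := by
      intro ha
      have e1 : n - J ≤ a ↔ n - a ≤ J := by omega
      rw [e1, hJ, Nat.le_floor_iff (by positivity), Nat.cast_sub ha.le]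
      have e2 : ((n:ℝ) - a ≤ n * (q:ℝ)^2) ↔ ((n:ℚ) - a ≤ n * q^2) := by exact_mod_cast Iff.rfl
      rw [e2]
      constructor <;> intro h <;> linarith
    constructor
    · rintro ⟨ha, hb, hc⟩
      exact ⟨(key ha).1 hb, ha⟩
    · rintro ⟨hb, ha⟩
      exact ⟨ha, (key ha).2 hb, by exact_mod_cast ha.le⟩
  rw [this, Nat.card_Ico]
  omega

lemma aux_G (T : ℕ) (hT : 1 ≤ T) : |G T - (F T : ℝ) / 24| ≤ T := by
  have hT' : (1:ℝ) ≤ T := by exact_mod_cast hT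
  have hG : G T = ∑ n ∈ Finset.Ioc 0 T, (mertens (T / n) : ℝ) *
      ∑ a ∈ Finset.range (n / 2 + 1), ((((a : ℚ) / n : ℚ) : ℝ))^2 := by
    unfold G; exact aux_L2 T (fun q => (q:ℝ)^2)
  have hterm : ∀ n ∈ Finset.Ioc 0 T, |(mertens (T / n) : ℝ) *
      ∑ a ∈ Finset.range (n / 2 + 1), ((((a : ℚ) / n : ℚ) : ℝ))^2 - (mertens (T / n) : ℝ) * n / 24
        - (if 2 ∣ n then (mertens (T / n) : ℝ) else 0) / 8| ≤ (T:ℝ)/12 * (1 / (n:ℝ)^2) := by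
    intro n hn
    simp only [Finset.mem_Ioc] at hn
    have hn' : (0:ℝ) < n := by exact_mod_cast hn.1
    have hs : ∑ a ∈ Finset.range (n / 2 + 1), ((((a : ℚ) / n : ℚ) : ℝ))^2 =
        (((n/2:ℕ):ℝ) * (((n/2:ℕ):ℝ)+1)*(2*((n/2:ℕ):ℝ)+1)/6) / n^2 := by
      rw [← aux_sumsq, Finset.sum_div]
      apply Finset.sum_congr rfl
      intro a _
      push_cast
      rw [div_pow]
    rw [hs]
    have hM := aux_Mbound T n
    set M := (mertens (T / n) : ℝ)
    have hb : (T:ℝ)/12 * (1 / (n:ℝ)^2) = (T/n) * (1/(12*n)) := by field_simp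
    rw [hb]
    rcases Nat.even_or_odd' n with ⟨c, hc | hc⟩
    · have h2 : n / 2 = c := by omega
      have hd : 2 ∣ n := ⟨c, hc⟩
      rw [if_pos hd, h2]
      have hcn : (c:ℝ) = n/2 := by rw [hc]; push_cast; ring
      have e : M * ((c:ℝ) * (c+1)*(2*c+1)/6 / n^2) - M*n/24 - M/8 = M * (1/(12*n)) := by
        rw [hcn]; field_simp; ring
      rw [e, abs_mul, abs_of_pos (by positivity : 0 < 1/(12*(n:ℝ)))]
      gcongr
    · have h2 : n / 2 = c := by omega
      have hd : ¬ 2 ∣ n := by omega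
      rw [if_neg hd, h2]
      have hcn : (c:ℝ) = (n-1)/2 := by rw [hc]; push_cast; ring
      have e : M * ((c:ℝ) * (c+1)*(2*c+1)/6 / n^2) - M*n/24 - 0/8 = -(M * (1/(24*n))) := by
        rw [hcn]; field_simp; ring
      rw [e, abs_neg, abs_mul, abs_of_pos (by positivity : 0 < 1/(24*(n:ℝ)))]
      gcongr
      norm_num
  have hev : |∑ n ∈ Finset.Ioc 0 T, (if 2 ∣ n then (mertens (T / n) : ℝ) else 0)| ≤ 1 := by
    rw [← Finset.sum_filter, ← Int.cast_sum]
    rcases Nat.lt_or_ge T 2 with h | h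
    · have : (Finset.Ioc 0 T).filter (fun n => 2 ∣ n) = ∅ := by
        ext n; simp; omega
      rw [this]; simp
    · rw [aux_Md T 2 (by norm_num) h]; simp
  have hsum := (Finset.abs_sum_le_sum_abs _ _).trans (Finset.sum_le_sum hterm)
  rw [Finset.sum_sub_distrib, Finset.sum_sub_distrib, ← hG, ← Finset.sum_div, ← Finset.sum_div,
    ← aux_F, ← Finset.mul_sum] at hsum
  have h3 : (T:ℝ)/12 * ∑ n ∈ Finset.Ioc 0 T, 1 / (n:ℝ)^2 ≤ T/12 * 3 := by
    gcongr; exact aux_sq T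
  rw [abs_le] at *
  constructor <;> linarith [hsum.1, hsum.2, hev.1, hev.2]

lemma aux_C (T : ℕ) (hT : 1 ≤ T) : (C T : ℝ) = (F T : ℝ) * G T - (fareyHalf T).card / 2
    - ∑ m ∈ Finset.Ioc 0 T, ∑ n ∈ Finset.Ioc 0 T, (mertens (T / m) : ℝ) * ((mertens (T / n) : ℝ) *
      ∑ a ∈ Finset.range (n/2+1), ((m:ℝ) * ((a:ℝ)/n)^2 - 1/2 - (⌊(m:ℝ) * ((a:ℝ)/n)^2⌋₊ : ℝ))) := by
  have h1 : (C T : ℝ) = ∑ q ∈ fareyHalf T, ∑ m ∈ Finset.Ioc 0 T, (mertens (T / m) : ℝ) * (⌊(m:ℝ) * (q:ℝ)^2⌋₊ : ℝ) := by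
    unfold C
    rw [Nat.cast_sum]
    apply Finset.sum_congr rfl
    intro q hq
    unfold fareyHalf at hq
    rw [Finset.mem_filter, aux_mem] at hq
    exact aux_N T q hq.1.1 hq.2
  have hone : ∑ m ∈ Finset.Ioc 0 T, (mertens (T / m) : ℝ) = 1 := by
    exact_mod_cast aux_M1 T hT
  have h2 : ∀ q ∈ fareyHalf T, ∑ m ∈ Finset.Ioc 0 T, (mertens (T / m) : ℝ) * (⌊(m:ℝ) * (q:ℝ)^2⌋₊ : ℝ)
      = (F T : ℝ) * (q:ℝ)^2 - 1/2 - ∑ m ∈ Finset.Ioc 0 T, (mertens (T / m) : ℝ) *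
        ((m:ℝ) * (q:ℝ)^2 - 1/2 - (⌊(m:ℝ) * (q:ℝ)^2⌋₊ : ℝ)) := by
    intro q _
    have e : (1/2 : ℝ) = ∑ m ∈ Finset.Ioc 0 T, (mertens (T / m) : ℝ) * (1/2) := by
      rw [← Finset.sum_mul, hone]; norm_num
    conv_rhs => enter [1, 2]; rw [e]
    rw [aux_F, Finset.sum_mul, ← Finset.sum_sub_distrib, ← Finset.sum_sub_distrib]
    apply Finset.sum_congr rfl
    intro m _
    ring
  rw [h1, Finset.sum_congr rfl h2, Finset.sum_sub_distrib, Finset.sum_sub_distrib, ← Finset.mul_sum,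
    Finset.sum_comm]
  congr 1
  · unfold G
    simp
    ring
  · apply Finset.sum_congr rfl
    intro m _
    rw [← Finset.mul_sum, aux_L2 T (fun q => (m:ℝ) * (q:ℝ)^2 - 1/2 - (⌊(m:ℝ) * (q:ℝ)^2⌋₊ : ℝ)), Finset.mul_sum]
    push_cast
    rfl

/-- Corollary 1.2: `C(T) = F(T)²/24 + O(T³)`. -/
theorem CT_eq_FT_sq_div_24 :
    ∃ K : ℝ, 0 < K ∧ ∀ T : ℕ, 1 ≤ T →
      |(C T : ℝ) - (1 / 24) * (F T : ℝ) ^ 2| ≤ K * (T : ℝ) ^ 3 := by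
  refine ⟨11, by norm_num, ?_⟩
  intro T hT
  have hT' : (1:ℝ) ≤ T := by exact_mod_cast hT
  rw [aux_C T hT]
  set W := ∑ m ∈ Finset.Ioc 0 T, ∑ n ∈ Finset.Ioc 0 T, (mertens (T / m) : ℝ) * ((mertens (T / n) : ℝ) *
      ∑ a ∈ Finset.range (n/2+1), ((m:ℝ) * ((a:ℝ)/n)^2 - 1/2 - (⌊(m:ℝ) * ((a:ℝ)/n)^2⌋₊ : ℝ))) with hW
  have hWb : |W| ≤ 9 * (T:ℝ)^3 := by
    have hterm : ∀ m ∈ Finset.Ioc 0 T, ∀ n ∈ Finset.Ioc 0 T,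
        |(mertens (T / m) : ℝ) * ((mertens (T / n) : ℝ) *
      ∑ a ∈ Finset.range (n/2+1), ((m:ℝ) * ((a:ℝ)/n)^2 - 1/2 - (⌊(m:ℝ) * ((a:ℝ)/n)^2⌋₊ : ℝ)))|
        ≤ (T:ℝ)^2 * (1 / ((m:ℝ) * √(m:ℝ))) + 3 * (T:ℝ)^2 * (min (m:ℝ) n / (m * n)) := by
      intro m hm n hn
      simp only [Finset.mem_Ioc] at hm hn
      have hm' : (0:ℝ) < m := by exact_mod_cast hm.1
      have hn' : (0:ℝ) < n := by exact_mod_cast hn.1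
      have h1 := aux_B m n (n/2) hm.1 hn.1 (by omega)
      have h2 := aux_Btriv m n (n/2) hn.1 (by omega)
      set B := ∑ a ∈ Finset.range (n/2+1), ((m:ℝ) * ((a:ℝ)/n)^2 - 1/2 - (⌊(m:ℝ) * ((a:ℝ)/n)^2⌋₊ : ℝ))
      have hs : 0 < √(m:ℝ) := by positivity
      have h3 : |B| ≤ n / √(m:ℝ) + 3 * min (m:ℝ) n := by
        have : 0 < n / √(m:ℝ) := by positivity
        rcases le_total (m:ℝ) n with h | h
        · rw [min_eq_left h]; exact h1
        · rw [min_eq_right h]; linarith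
      rw [abs_mul, abs_mul]
      calc _ ≤ (T:ℝ)/m * ((T:ℝ)/n * (n / √(m:ℝ) + 3 * min (m:ℝ) n)) := by
            gcongr
            · exact aux_Mbound T m
            · exact aux_Mbound T n
        _ = _ := by field_simp
    have hb : |W| ≤ ∑ m ∈ Finset.Ioc 0 T, ∑ n ∈ Finset.Ioc 0 T,
        ((T:ℝ)^2 * (1 / ((m:ℝ) * √(m:ℝ))) + 3 * (T:ℝ)^2 * (min (m:ℝ) n / (m * n))) := by
      refine (Finset.abs_sum_le_sum_abs _ _).trans (Finset.sum_le_sum fun m hm => ?_)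
      exact (Finset.abs_sum_le_sum_abs _ _).trans (Finset.sum_le_sum fun n hn => hterm m hm n hn)
    have he : ∑ m ∈ Finset.Ioc 0 T, ∑ n ∈ Finset.Ioc 0 T,
        ((T:ℝ)^2 * (1 / ((m:ℝ) * √(m:ℝ))) + 3 * (T:ℝ)^2 * (min (m:ℝ) n / (m * n)))
        = (T:ℝ)^3 * (∑ m ∈ Finset.Ioc 0 T, 1 / ((m:ℝ) * √(m:ℝ))) + 3 * (T:ℝ)^2 *
          ∑ m ∈ Finset.Ioc 0 T, ∑ n ∈ Finset.Ioc 0 T, (min (m:ℝ) n / (m * n)) := by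
      simp only [Finset.sum_add_distrib, Finset.mul_sum, Finset.sum_const, Nat.card_Ioc, nsmul_eq_mul]
      congr 1
      apply Finset.sum_congr rfl
      intro m _
      simp only [Nat.sub_zero]
      ring
    rw [he] at hb
    calc |W| ≤ _ := hb
      _ ≤ (T:ℝ)^3 * 3 + 3 * (T:ℝ)^2 * (2 * T) := by
          gcongr
          · exact aux_32 T
          · exact aux_minsum T
      _ = _ := by ring
  have hFG : |(F T : ℝ) * (G T - (F T : ℝ)/24)| ≤ (T:ℝ)^3 := by
    rw [abs_mul, abs_of_nonneg (by positivity)]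
    calc _ ≤ (T:ℝ)^2 * T := by
          gcongr
          · exact aux_F_le T
          · exact aux_G T hT
      _ = _ := by ring
  have hh : ((fareyHalf T).card : ℝ) ≤ (T:ℝ)^3 := by
    have h1 : ((fareyHalf T).card : ℝ) ≤ F T := by
      exact_mod_cast Finset.card_filter_le _ _
    have h2 := aux_F_le T
    have h3 : (T:ℝ)^2 ≤ (T:ℝ)^3 := pow_le_pow_right₀ hT' (by norm_num)
    linarith
  have hh0 : (0:ℝ) ≤ ((fareyHalf T).card : ℝ) := by positivity
  have e : (F T : ℝ) * G T - (fareyHalf T).card / 2 - W - 1/24 * (F T : ℝ)^2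
    = (F T : ℝ) * (G T - (F T : ℝ)/24) - (fareyHalf T).card / 2 - W := by ring
  rw [e]
  rw [abs_le] at *
  constructor <;> linarith [hWb.1, hWb.2, hFG.1, hFG.2]
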